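/- For all x_A, x_C ∈ ℝ, the function x_D ↦ max_{x_B ∈ ℝ} π_B(x_A, x_B, x_C, x_D) (the inner maximum being attained since π_B is a strictly concave quadratic in x_B) attains its minimum over ℝ at the unique point x_D = (6a − 3c_B − 3c_D − 8x_A − 8x_C)/8; and for all x_A, x_B ∈ ℝ, the function x_D ↦ max_{x_C ∈ ℝ} π_C(x_A, x_B, x_C, x_D) attains its minimum over ℝ at the unique point x_D = (6a − 3c_C − 3c_D − 8x_A − 8x_B)/8. -/

import Mathlib

/-- Absolute profit of a firm with output `x`, marginal cost `c`, demand intercept `a`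
and total industry output `s`. -/
noncomputable def absProfit (a c x s : ℝ) : ℝ := (a - s) * x - c * x

/-- Relative profit of firm A. -/
noncomputable def piA (a cA cB cC cD xA xB xC xD : ℝ) : ℝ :=
  absProfit a cA xA (xA + xB + xC + xD) -
    (1 / 3) * (absProfit a cB xB (xA + xB + xC + xD) +
      absProfit a cC xC (xA + xB + xC + xD) +
      absProfit a cD xD (xA + xB + xC + xD))

/-- Relative profit of firm B. -/
noncomputable def piB (a cA cB cC cD xA xB xC xD : ℝ) : ℝ :=
  absProfit a cB xB (xA + xB + xC + xD) -
    (1 / 3) * (absProfit a cA xA (xA + xB + xC + xD) +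
      absProfit a cC xC (xA + xB + xC + xD) +
      absProfit a cD xD (xA + xB + xC + xD))

/-- Relative profit of firm C. -/
noncomputable def piC (a cA cB cC cD xA xB xC xD : ℝ) : ℝ :=
  absProfit a cC xC (xA + xB + xC + xD) -
    (1 / 3) * (absProfit a cA xA (xA + xB + xC + xD) +
      absProfit a cB xB (xA + xB + xC + xD) +
      absProfit a cD xD (xA + xB + xC + xD))

/-- Relative profit of firm D. -/
noncomputable def piD (a cA cB cC cD xA xB xC xD : ℝ) : ℝ :=
  absProfit a cD xD (xA + xB + xC + xD) -
    (1 / 3) * (absProfit a cA xA (xA + xB + xC + xD) +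
      absProfit a cB xB (xA + xB + xC + xD) +
      absProfit a cC xC (xA + xB + xC + xD))

theorem piB_greatest (a cA cB cC cD xA xC xD : ℝ) :
    IsGreatest (Set.range fun xB => piB a cA cB cC cD xA xB xC xD)
      (piB a cA cB cC cD xA ((a - cB - 2 * (xA + xC + xD) / 3) / 2) xC xD) := by
  refine ⟨⟨_, rfl⟩, ?_⟩
  rintro _ ⟨y, rfl⟩
  simp only [piB, absProfit]
  nlinarith [sq_nonneg (y - (a - cB - 2 * (xA + xC + xD) / 3) / 2)]

theorem piB_part (a cA cB cC cD xA xC : ℝ) :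
      (∀ xD : ℝ,
        IsGreatest (Set.range fun xB => piB a cA cB cC cD xA xB xC xD)
          (sSup (Set.range fun xB => piB a cA cB cC cD xA xB xC xD))) ∧
      (∀ xD : ℝ,
        sSup (Set.range fun xB =>
            piB a cA cB cC cD xA xB xC ((6 * a - 3 * cB - 3 * cD - 8 * xA - 8 * xC) / 8)) ≤
          sSup (Set.range fun xB => piB a cA cB cC cD xA xB xC xD)) ∧
      (∀ xD : ℝ,
        sSup (Set.range fun xB => piB a cA cB cC cD xA xB xC xD) =
          sSup (Set.range fun xB =>
            piB a cA cB cC cD xA xB xC ((6 * a - 3 * cB - 3 * cD - 8 * xA - 8 * xC) / 8)) →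
        xD = (6 * a - 3 * cB - 3 * cD - 8 * xA - 8 * xC) / 8) := by
  have hS : ∀ xD, sSup (Set.range fun xB => piB a cA cB cC cD xA xB xC xD) = _ :=
    fun xD => (piB_greatest a cA cB cC cD xA xC xD).csSup_eq
  have key : ∀ xD, sSup (Set.range fun xB => piB a cA cB cC cD xA xB xC xD) =
      sSup (Set.range fun xB =>
        piB a cA cB cC cD xA xB xC ((6 * a - 3 * cB - 3 * cD - 8 * xA - 8 * xC) / 8)) +
      4 / 9 * (xD - (6 * a - 3 * cB - 3 * cD - 8 * xA - 8 * xC) / 8) ^ 2 := by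
    intro xD
    rw [hS, hS]
    simp only [piB, absProfit]
    ring
  refine ⟨fun xD => ?_, fun xD => ?_, fun xD h => ?_⟩
  · rw [hS]
    exact piB_greatest a cA cB cC cD xA xC xD
  · rw [key xD]
    have := sq_nonneg (xD - (6 * a - 3 * cB - 3 * cD - 8 * xA - 8 * xC) / 8)
    linarith
  · rw [key xD] at h
    have h2 : (xD - (6 * a - 3 * cB - 3 * cD - 8 * xA - 8 * xC) / 8) ^ 2 = 0 := by linarith
    exact sub_eq_zero.mp (pow_eq_zero_iff (two_ne_zero)|>.mp h2)

theorem piC_eq_piB (a cA cB cC cD xA xB xC xD : ℝ) :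
    piC a cA cB cC cD xA xB xC xD = piB a cA cC cB cD xA xC xB xD := by
  simp only [piB, piC, absProfit]
  ring

/-- Firm D's minimax strategies against firms B and C: `x_D ↦ max_{x_B} π_B` attains its
minimum at the unique point `(6a - 3c_B - 3c_D - 8x_A - 8x_C)/8`, and
`x_D ↦ max_{x_C} π_C` attains its minimum at the unique point
`(6a - 3c_C - 3c_D - 8x_A - 8x_B)/8` (the inner maxima being attained). -/
theorem minimax_strategies_firm_D_vs_B_C (a cA cB cC cD : ℝ) :
    (∀ xA xC : ℝ,
      (∀ xD : ℝ,
        IsGreatest (Set.range fun xB => piB a cA cB cC cD xA xB xC xD)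
          (sSup (Set.range fun xB => piB a cA cB cC cD xA xB xC xD))) ∧
      (∀ xD : ℝ,
        sSup (Set.range fun xB =>
            piB a cA cB cC cD xA xB xC ((6 * a - 3 * cB - 3 * cD - 8 * xA - 8 * xC) / 8)) ≤
          sSup (Set.range fun xB => piB a cA cB cC cD xA xB xC xD)) ∧
      (∀ xD : ℝ,
        sSup (Set.range fun xB => piB a cA cB cC cD xA xB xC xD) =
          sSup (Set.range fun xB =>
            piB a cA cB cC cD xA xB xC ((6 * a - 3 * cB - 3 * cD - 8 * xA - 8 * xC) / 8)) →
        xD = (6 * a - 3 * cB - 3 * cD - 8 * xA - 8 * xC) / 8)) ∧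
    (∀ xA xB : ℝ,
      (∀ xD : ℝ,
        IsGreatest (Set.range fun xC => piC a cA cB cC cD xA xB xC xD)
          (sSup (Set.range fun xC => piC a cA cB cC cD xA xB xC xD))) ∧
      (∀ xD : ℝ,
        sSup (Set.range fun xC =>
            piC a cA cB cC cD xA xB xC ((6 * a - 3 * cC - 3 * cD - 8 * xA - 8 * xB) / 8)) ≤
          sSup (Set.range fun xC => piC a cA cB cC cD xA xB xC xD)) ∧
      (∀ xD : ℝ,
        sSup (Set.range fun xC => piC a cA cB cC cD xA xB xC xD) =
          sSup (Set.range fun xC =>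
            piC a cA cB cC cD xA xB xC ((6 * a - 3 * cC - 3 * cD - 8 * xA - 8 * xB) / 8)) →
        xD = (6 * a - 3 * cC - 3 * cD - 8 * xA - 8 * xB) / 8)) := by
  refine ⟨fun xA xC => piB_part a cA cB cC cD xA xC, fun xA xB => ?_⟩
  simp only [piC_eq_piB]
  exact piB_part a cA cC cB cD xA xB
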